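/- (Finiteness and positivity of the supremal growth rate Λ, equation (2.33).) Define Λ := sup{ s>0 : there exists k>0 with σ₋k²<g⟦ρ⟧ and α(k,s)=−s² }. Then the set over which the supremum is taken is nonempty, and 0 < Λ ≤ bg⟦ρ⟧/(4μ₋); in particular Λ is finite. -/

import Mathlib

open MeasureTheory Set

/-- Piecewise-constant coefficient on `(-b,1)`: value `vm` below the interface `{0}`,
value `vp` above. -/
noncomputable def pw (vm vp : ℝ) (x : ℝ) : ℝ := if x < 0 then vm else vp

/-- First derivative within `[-b,1]`. -/
noncomputable def d1 (b : ℝ) (ψ : ℝ → ℝ) : ℝ → ℝ := derivWithin ψ (Set.Icc (-b) 1)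

/-- Second derivative within `[-b,1]`. -/
noncomputable def d2 (b : ℝ) (ψ : ℝ → ℝ) : ℝ → ℝ := derivWithin (d1 b ψ) (Set.Icc (-b) 1)

/-- The viscous part `E1(ψ;k)` of the energy. -/
noncomputable def E1 (b μm μp k : ℝ) (ψ : ℝ → ℝ) : ℝ :=
  (1 / 2) * ∫ x in (-b)..1,
    pw μm μp x * (4 * k ^ 2 * d1 b ψ x ^ 2 + (k ^ 2 * ψ x + d2 b ψ x) ^ 2)

/-- The boundary part `E0(ψ;k)` of the energy. -/
noncomputable def E0 (b g ρm ρp σm σp k : ℝ) (ψ : ℝ → ℝ) : ℝ :=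
  k ^ 2 / 2 * (σp * k ^ 2 + g * ρp) * ψ 1 ^ 2
    + k ^ 2 / 2 * (σm * k ^ 2 - g * (ρp - ρm)) * ψ 0 ^ 2

/-- The total energy `E(ψ;k,s) = s E1(ψ;k) + E0(ψ;k)`. -/
noncomputable def En (b g ρm ρp μm μp σm σp k s : ℝ) (ψ : ℝ → ℝ) : ℝ :=
  s * E1 b μm μp k ψ + E0 b g ρm ρp σm σp k ψ

/-- The normalization functional `J(ψ;k)`. -/
noncomputable def Jen (b ρm ρp k : ℝ) (ψ : ℝ → ℝ) : ℝ :=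
  (1 / 2) * ∫ x in (-b)..1, pw ρm ρp x * (k ^ 2 * ψ x ^ 2 + d1 b ψ x ^ 2)

/-- The admissible class `𝒜`: `ψ : ℝ → ℝ` twice continuously differentiable on `[-b,1]`
with `ψ(-b) = ψ'(-b) = 0`. -/
def memA (b : ℝ) (ψ : ℝ → ℝ) : Prop :=
  ContDiffOn ℝ 2 ψ (Set.Icc (-b) 1) ∧ ψ (-b) = 0 ∧ d1 b ψ (-b) = 0

/-- The set of energy values over the constraint class `𝒞(k) = {ψ ∈ 𝒜 : J(ψ;k) = 1}`. -/
noncomputable def enSet (b g ρm ρp μm μp σm σp k s : ℝ) : Set ℝ :=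
  En b g ρm ρp μm μp σm σp k s '' {ψ : ℝ → ℝ | memA b ψ ∧ Jen b ρm ρp k ψ = 1}

/-- `α(k,s) := inf {E(ψ;k,s) : ψ ∈ 𝒞(k)}`. -/
noncomputable def alpha (b g ρm ρp μm μp σm σp k s : ℝ) : ℝ :=
  sInf (enSet b g ρm ρp μm μp σm σp k s)

/-- The set of achievable growth rates: `s > 0` such that `α(k,s) = -s²` for some
subcritical frequency `k > 0`. -/
noncomputable def growthRates (b g ρm ρp μm μp σm σp : ℝ) : Set ℝ :=
  {s : ℝ | 0 < s ∧ ∃ k : ℝ, 0 < k ∧ σm * k ^ 2 < g * (ρp - ρm) ∧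
    alpha b g ρm ρp μm μp σm σp k s = -(s ^ 2)}


lemma pw_intervalIntegrable (vm vp x y : ℝ) : IntervalIntegrable (pw vm vp) volume x y := by
  have h : pw vm vp = fun x => (Set.Iio (0:ℝ)).indicator (fun _ => vm - vp) x + vp := by
    funext x
    by_cases hx : x < 0 <;> simp [pw, Set.indicator, hx]
  rw [h]
  have h2 : IntervalIntegrable (fun _ : ℝ => vm - vp) volume x y := intervalIntegrable_const
  exact IntervalIntegrable.add ⟨h2.1.indicator measurableSet_Iio, h2.2.indicator measurableSet_Iio⟩
    intervalIntegrable_const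

lemma pw_mul_int {b vm vp : ℝ} {F : ℝ → ℝ} (hb : 0 < b) (hF : ContinuousOn F (Icc (-b) 1)) :
    IntervalIntegrable (fun x => pw vm vp x * F x) volume (-b) 1 := by
  apply (pw_intervalIntegrable vm vp (-b) 1).mul_continuousOn
  rwa [uIcc_of_le (by linarith)]

lemma pw_nonneg {vm vp : ℝ} (hm : 0 ≤ vm) (hp : 0 ≤ vp) (x : ℝ) : 0 ≤ pw vm vp x := by
  unfold pw; split_ifs <;> assumption

lemma pw_lower {b vm vp : ℝ} {F G : ℝ → ℝ} (hb : 0 < b) (hm : 0 ≤ vm) (hp : 0 ≤ vp)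
    (hF : ContinuousOn F (Icc (-b) 1)) (hG : ContinuousOn G (Icc (-b) 1))
    (h0 : ∀ x, 0 ≤ F x) (hGF : ∀ x, G x ≤ F x) :
    vm * ∫ x in (-b)..0, G x ≤ ∫ x in (-b)..1, pw vm vp x * F x := by
  have hi := pw_mul_int (vm := vm) (vp := vp) hb hF
  have hi1 : IntervalIntegrable (fun x => pw vm vp x * F x) volume (-b) 0 := by
    apply hi.mono_set
    rw [uIcc_of_le (by linarith), uIcc_of_le (by linarith)]
    exact Icc_subset_Icc le_rfl (by norm_num)
  have hi2 : IntervalIntegrable (fun x => pw vm vp x * F x) volume 0 1 := by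
    apply hi.mono_set
    rw [uIcc_of_le (by linarith), uIcc_of_le (by linarith)]
    exact Icc_subset_Icc (by linarith) le_rfl
  rw [← intervalIntegral.integral_add_adjacent_intervals hi1 hi2]
  have h2 : 0 ≤ ∫ x in (0:ℝ)..1, pw vm vp x * F x :=
    intervalIntegral.integral_nonneg (by norm_num)
      (fun x _ => mul_nonneg (pw_nonneg hm hp x) (h0 x))
  have hGi : IntervalIntegrable G volume (-b) 0 := by
    apply ContinuousOn.intervalIntegrable
    rw [uIcc_of_le (by linarith)]
    exact hG.mono (Icc_subset_Icc le_rfl (by norm_num))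
  rw [← intervalIntegral.integral_const_mul]
  have h1 : ∫ x in (-b)..0, vm * G x ≤ ∫ x in (-b)..0, pw vm vp x * F x := by
    apply intervalIntegral.integral_mono_on_of_le_Ioo (by linarith) (hGi.const_mul vm) hi1
    intro x hx
    rw [pw, if_pos hx.2]
    exact mul_le_mul_of_nonneg_left (hGF x) hm
  linarith

lemma cont_d {b : ℝ} {ψ : ℝ → ℝ} (hb : 0 < b) (h : ContDiffOn ℝ 2 ψ (Icc (-b) 1)) :
    ContinuousOn ψ (Icc (-b) 1) ∧ ContinuousOn (d1 b ψ) (Icc (-b) 1) ∧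
      ContinuousOn (d2 b ψ) (Icc (-b) 1) := by
  have hu : UniqueDiffOn ℝ (Icc (-b) 1) := uniqueDiffOn_Icc (by linarith)
  have h1 : ContDiffOn ℝ 1 (d1 b ψ) (Icc (-b) 1) := h.derivWithin hu (by norm_num)
  exact ⟨h.continuousOn, h1.continuousOn, h1.continuousOn_derivWithin hu le_rfl⟩

lemma poincare {b : ℝ} {ψ : ℝ → ℝ} (hb : 0 < b) (h : memA b ψ) :
    ψ 0 ^ 2 ≤ b * ∫ x in (-b)..0, d1 b ψ x ^ 2 := by
  obtain ⟨h, hz, -⟩ := h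
  obtain ⟨c0, c1, -⟩ := cont_d hb h
  have hsub : Icc (-b) 0 ⊆ Icc (-b) 1 := Icc_subset_Icc le_rfl (by norm_num)
  have c1' : ContinuousOn (d1 b ψ) (uIcc (-b) 0) := by
    rw [uIcc_of_le (by linarith)]; exact c1.mono hsub
  have ftc : ∫ x in (-b)..0, d1 b ψ x = ψ 0 := by
    rw [intervalIntegral.integral_eq_sub_of_hasDerivAt_of_le (f := ψ) (by linarith)
      (c0.mono hsub) _ c1'.intervalIntegrable, hz, sub_zero]
    intro x hx
    have hn : Icc (-b) 1 ∈ nhds x := Icc_mem_nhds hx.1 (by linarith [hx.2])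
    have hd := (h.differentiableOn (by norm_num) x (mem_of_mem_nhds hn)).hasDerivWithinAt
    exact hd.hasDerivAt hn
  have key : 0 ≤ ∫ x in (-b)..0, (b * d1 b ψ x - ψ 0) ^ 2 :=
    intervalIntegral.integral_nonneg (by linarith) (fun x _ => sq_nonneg _)
  have e : ∫ x in (-b)..0, (b * d1 b ψ x - ψ 0) ^ 2
      = b ^ 2 * (∫ x in (-b)..0, d1 b ψ x ^ 2) - 2 * b * ψ 0 * ψ 0 + b * ψ 0 ^ 2 := by
    have : ∀ x, (b * d1 b ψ x - ψ 0) ^ 2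
        = b ^ 2 * d1 b ψ x ^ 2 - (2 * b * ψ 0) * d1 b ψ x + ψ 0 ^ 2 := fun x => by ring
    simp_rw [this]
    have i2 : IntervalIntegrable (fun x => b ^ 2 * d1 b ψ x ^ 2) volume (-b) 0 :=
      ((c1'.pow 2).intervalIntegrable).const_mul _
    have i1 : IntervalIntegrable (fun x => (2 * b * ψ 0) * d1 b ψ x) volume (-b) 0 :=
      c1'.intervalIntegrable.const_mul _
    rw [intervalIntegral.integral_add (i2.sub i1) intervalIntegrable_const,
      intervalIntegral.integral_sub i2 i1, intervalIntegral.integral_const_mul,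
      intervalIntegral.integral_const_mul, ftc, intervalIntegral.integral_const]
    simp
  rw [e] at key
  have : 0 ≤ b * (b * (∫ x in (-b)..0, d1 b ψ x ^ 2) - ψ 0 ^ 2) := by nlinarith
  have := nonneg_of_mul_nonneg_right this hb
  linarith

lemma E1_lower {b μm μp k : ℝ} {ψ : ℝ → ℝ} (hb : 0 < b) (hm : 0 < μm) (hp : 0 < μp)
    (h : memA b ψ) : 2 * k ^ 2 * μm * ψ 0 ^ 2 ≤ b * E1 b μm μp k ψ := by
  have hP := poincare hb h
  obtain ⟨c0, c1, c2⟩ := cont_d hb h.1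
  have h1 := pw_lower (b := b) (vm := μm) (vp := μp)
    (F := fun x => 4 * k ^ 2 * d1 b ψ x ^ 2 + (k ^ 2 * ψ x + d2 b ψ x) ^ 2)
    (G := fun x => 4 * k ^ 2 * d1 b ψ x ^ 2) hb hm.le hp.le (by fun_prop) (by fun_prop)
    (fun x => by positivity) (fun x => by nlinarith [sq_nonneg (k ^ 2 * ψ x + d2 b ψ x)])
  rw [intervalIntegral.integral_const_mul] at h1
  unfold E1
  have h3 := mul_le_mul_of_nonneg_left hP (show 0 ≤ 2 * k ^ 2 * μm by positivity)
  have h4 := mul_le_mul_of_nonneg_left h1 (show 0 ≤ b / 2 by positivity)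
  linarith

lemma J_lower {b ρm ρp k : ℝ} {ψ : ℝ → ℝ} (hb : 0 < b) (hm : 0 < ρm) (hp : 0 < ρp)
    (h : memA b ψ) : ρm * ψ 0 ^ 2 ≤ 2 * b * Jen b ρm ρp k ψ := by
  have hP := poincare hb h
  obtain ⟨c0, c1, c2⟩ := cont_d hb h.1
  have h1 := pw_lower (b := b) (vm := ρm) (vp := ρp)
    (F := fun x => k ^ 2 * ψ x ^ 2 + d1 b ψ x ^ 2)
    (G := fun x => d1 b ψ x ^ 2) hb hm.le hp.le (by fun_prop) (by fun_prop)
    (fun x => by positivity) (fun x => by nlinarith [sq_nonneg (k * ψ x)])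
  unfold Jen
  have h3 := mul_le_mul_of_nonneg_left hP hm.le
  have h4 := mul_le_mul_of_nonneg_left h1 hb.le
  linarith

lemma E0_lower {b g ρm ρp σm σp k : ℝ} (ψ : ℝ → ℝ) (hg : 0 < g) (hρm : 0 < ρm) (hρ : ρm < ρp)
    (hσm : 0 ≤ σm) (hσp : 0 ≤ σp) :
    -(k ^ 2 / 2 * (g * (ρp - ρm)) * ψ 0 ^ 2) ≤ E0 b g ρm ρp σm σp k ψ := by
  unfold E0
  have hρp : 0 < ρp := hρm.trans hρ
  have h1 : 0 ≤ k ^ 2 / 2 * (σp * k ^ 2 + g * ρp) * ψ 1 ^ 2 := by positivity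
  have h2 : 0 ≤ k ^ 2 / 2 * (σm * k ^ 2) * ψ 0 ^ 2 := by positivity
  linarith

lemma E1_nonneg {b μm μp k : ℝ} {ψ : ℝ → ℝ} (hb : 0 < b) (hm : 0 < μm) (hp : 0 < μp)
    (h : memA b ψ) : 0 ≤ E1 b μm μp k ψ := by
  have h1 := E1_lower (k := k) hb hm hp h
  have h2 : 0 ≤ b * E1 b μm μp k ψ := le_trans (by positivity) h1
  exact nonneg_of_mul_nonneg_right h2 hb

lemma exists_test {b ρm ρp : ℝ} (k : ℝ) (hb : 0 < b) (hm : 0 < ρm) (hp : 0 < ρp) :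
    ∃ ψ, memA b ψ ∧ Jen b ρm ρp k ψ = 1 ∧ ψ 1 = 0 ∧ ψ 0 ≠ 0 := by
  have hA : ∀ c : ℝ, memA b (fun x => c * ((x + b) ^ 2 * (1 - x))) := by
    intro c
    refine ⟨by fun_prop, by simp, ?_⟩
    have hd : HasDerivAt (fun x : ℝ => c * ((x + b) ^ 2 * (1 - x))) 0 (-b) := by
      have := ((((hasDerivAt_id (-b)).add_const b).pow 2).mul
        ((hasDerivAt_id (-b)).const_sub 1)).const_mul c
      exact this.congr_deriv (by simp)
    exact hd.hasDerivWithinAt.derivWithin (uniqueDiffOn_Icc (by linarith) _ (by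
      constructor <;> linarith))
  set φ : ℝ → ℝ := fun x => (x + b) ^ 2 * (1 - x) with hφ
  have hφA : memA b φ := by simpa [hφ] using hA 1
  have hφ0 : φ 0 ≠ 0 := by simp [hφ, hb.ne']
  have hJ : 0 < Jen b ρm ρp k φ := by
    have h1 := J_lower (k := k) hb hm hp hφA
    have h2 : 0 < ρm * φ 0 ^ 2 := by positivity
    have h3 := lt_of_lt_of_le h2 h1
    exact pos_of_mul_pos_right h3 (by positivity)
  have hs : ∀ c : ℝ, Jen b ρm ρp k (fun x => c * φ x) = c ^ 2 * Jen b ρm ρp k φ := by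
    intro c
    have hd : d1 b (fun x => c * φ x) = fun x => c * d1 b φ x := by
      funext x
      exact derivWithin_const_mul_field c
    unfold Jen
    rw [hd, mul_left_comm (c ^ 2), ← intervalIntegral.integral_const_mul (c ^ 2)]
    congr 1
    apply intervalIntegral.integral_congr
    intro x _
    simp only
    ring
  refine ⟨fun x => (Real.sqrt (Jen b ρm ρp k φ))⁻¹ * φ x, hA _, ?_, by simp [hφ], ?_⟩
  · rw [hs, inv_pow, Real.sq_sqrt hJ.le, inv_mul_cancel₀ hJ.ne']
  · exact mul_ne_zero (inv_ne_zero (Real.sqrt_pos.2 hJ).ne') hφ0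

lemma rate_le {b g ρm ρp μm μp σm σp : ℝ}
    (hb : 0 < b) (hg : 0 < g) (hρm : 0 < ρm) (hρ : ρm < ρp)
    (hμm : 0 < μm) (hμp : 0 < μp) (hσm : 0 ≤ σm) (hσp : 0 ≤ σp) {s : ℝ}
    (hs : s ∈ growthRates b g ρm ρp μm μp σm σp) : s ≤ b * g * (ρp - ρm) / (4 * μm) := by
  obtain ⟨hs0, k, hk, -, ha⟩ := hs
  by_contra hlt
  push Not at hlt
  rw [div_lt_iff₀ (by positivity)] at hlt
  have : 0 ≤ alpha b g ρm ρp μm μp σm σp k s := by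
    apply Real.sInf_nonneg
    rintro _ ⟨ψ, ⟨hψ, -⟩, rfl⟩
    have h1 := mul_le_mul_of_nonneg_left (E1_lower (k := k) hb hμm hμp hψ) hs0.le
    have h2 := mul_le_mul_of_nonneg_left
      (E0_lower (b := b) (k := k) ψ hg hρm hρ hσm hσp) hb.le
    have h3 := mul_le_mul_of_nonneg_left hlt.le (show 0 ≤ k ^ 2 / 2 * ψ 0 ^ 2 by positivity)
    refine nonneg_of_mul_nonneg_right (a := b) ?_ hb
    unfold En
    linarith
  rw [ha] at this
  nlinarith

lemma rate_exists {b g ρm ρp μm μp σm σp : ℝ}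
    (hb : 0 < b) (hg : 0 < g) (hρm : 0 < ρm) (hρ : ρm < ρp)
    (hμm : 0 < μm) (hμp : 0 < μp) (hσm : 0 ≤ σm) (hσp : 0 ≤ σp) :
    (growthRates b g ρm ρp μm μp σm σp).Nonempty := by
  have hρp : 0 < ρp := hρm.trans hρ
  have hG : 0 < g * (ρp - ρm) := mul_pos hg (by linarith)
  obtain ⟨k, hk, hkc⟩ : ∃ k : ℝ, 0 < k ∧ σm * k ^ 2 < g * (ρp - ρm) := by
    refine ⟨Real.sqrt (g * (ρp - ρm) / (σm + 1)), Real.sqrt_pos.2 (by positivity), ?_⟩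
    rw [Real.sq_sqrt (by positivity), mul_div_assoc', div_lt_iff₀ (by positivity)]
    nlinarith
  set C : ℝ := k ^ 2 * g * (ρp - ρm) * b / ρm with hC
  have hCpos : 0 < C := by
    have : 0 < ρp - ρm := by linarith
    positivity
  have hlow : ∀ s, 0 < s → ∀ v ∈ enSet b g ρm ρp μm μp σm σp k s, -C ≤ v := by
    rintro s hs _ ⟨ψ, ⟨hψ, hJ⟩, rfl⟩
    have h1 := mul_nonneg hs.le (E1_nonneg (k := k) hb hμm hμp hψ)
    have h2 := E0_lower (b := b) (k := k) ψ hg hρm hρ hσm hσp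
    have h3 := J_lower (k := k) hb hρm hρp hψ
    rw [hJ] at h3
    have h4 : k ^ 2 / 2 * (g * (ρp - ρm)) * ψ 0 ^ 2 ≤ C := by
      rw [hC, le_div_iff₀ hρm]
      have := mul_le_mul_of_nonneg_left h3 (show 0 ≤ k ^ 2 / 2 * (g * (ρp - ρm)) by positivity)
      linarith
    unfold En
    linarith
  have hbdd : ∀ s, 0 < s → BddBelow (enSet b g ρm ρp μm μp σm σp k s) :=
    fun s hs => ⟨-C, fun v hv => hlow s hs v hv⟩
  obtain ⟨ψ, hψ, hJ, hψ1, hψ0⟩ := exists_test k hb hρm hρp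
  have hne : ∀ s, (enSet b g ρm ρp μm μp σm σp k s).Nonempty :=
    fun s => ⟨_, ψ, ⟨hψ, hJ⟩, rfl⟩
  have hconc : ConcaveOn ℝ (Ioi 0) (alpha b g ρm ρp μm μp σm σp k) := by
    refine ⟨convex_Ioi 0, ?_⟩
    intro s hs t ht p q hp hq hpq
    apply le_csInf (hne _)
    rintro _ ⟨χ, hχ, rfl⟩
    have h1 : alpha b g ρm ρp μm μp σm σp k s ≤ En b g ρm ρp μm μp σm σp k s χ :=
      csInf_le (hbdd s hs) ⟨χ, hχ, rfl⟩
    have h2 : alpha b g ρm ρp μm μp σm σp k t ≤ En b g ρm ρp μm μp σm σp k t χ :=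
      csInf_le (hbdd t ht) ⟨χ, hχ, rfl⟩
    have h3 := mul_le_mul_of_nonneg_left h1 hp
    have h4 := mul_le_mul_of_nonneg_left h2 hq
    have h5 : En b g ρm ρp μm μp σm σp k (p • s + q • t) χ
        = p * En b g ρm ρp μm μp σm σp k s χ + q * En b g ρm ρp μm μp σm σp k t χ := by
      obtain rfl : q = 1 - p := by linarith
      simp only [En, smul_eq_mul]
      ring
    simp only [smul_eq_mul] at *
    linarith
  have hcont : ContinuousOn (fun s => alpha b g ρm ρp μm μp σm σp k s + s ^ 2) (Ioi 0) :=
    (hconc.continuousOn isOpen_Ioi).add (by fun_prop)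
  -- small values of s
  have hE0 : E0 b g ρm ρp σm σp k ψ < 0 := by
    unfold E0
    rw [hψ1]
    have : 0 < k ^ 2 / 2 * (g * (ρp - ρm) - σm * k ^ 2) * ψ 0 ^ 2 := by
      have : 0 < g * (ρp - ρm) - σm * k ^ 2 := by linarith
      positivity
    nlinarith
  set A := E1 b μm μp k ψ with hA
  have hA0 : 0 ≤ A := E1_nonneg hb hμm hμp hψ
  set D := -E0 b g ρm ρp σm σp k ψ with hD
  have hDpos : 0 < D := by linarith
  set s₀ : ℝ := min 1 (D / (2 * (A + 1))) with hs₀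
  have hs₀pos : 0 < s₀ := lt_min one_pos (by positivity)
  have hs₀neg : alpha b g ρm ρp μm μp σm σp k s₀ + s₀ ^ 2 < 0 := by
    have h1 : alpha b g ρm ρp μm μp σm σp k s₀ ≤ s₀ * A - D := by
      have : alpha b g ρm ρp μm μp σm σp k s₀ ≤ En b g ρm ρp μm μp σm σp k s₀ ψ :=
        csInf_le (hbdd s₀ hs₀pos) ⟨ψ, ⟨hψ, hJ⟩, rfl⟩
      unfold En at this
      linarith
    have h2 : s₀ ≤ 1 := min_le_left _ _
    have h3 : s₀ ≤ D / (2 * (A + 1)) := min_le_right _ _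
    rw [le_div_iff₀ (by positivity)] at h3
    nlinarith
  set s₁ : ℝ := 1 + C with hs₁
  have hs₁pos : 0 ≤ alpha b g ρm ρp μm μp σm σp k s₁ + s₁ ^ 2 := by
    have : -C ≤ alpha b g ρm ρp μm μp σm σp k s₁ :=
      le_csInf (hne _) (hlow s₁ (by positivity))
    nlinarith
  have hle : s₀ ≤ s₁ := (min_le_left _ _).trans (by linarith)
  have hivt := intermediate_value_Icc hle
    (hcont.mono (fun x hx => lt_of_lt_of_le hs₀pos hx.1))
  obtain ⟨s, hs, hs'⟩ := hivt ⟨hs₀neg.le, hs₁pos⟩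
  exact ⟨s, lt_of_lt_of_le hs₀pos hs.1, k, hk, hkc, by
    simp only at hs'
    linarith⟩

/-- Finiteness and positivity of the supremal growth rate `Λ` (equation (2.33)): the set
of achievable growth rates is nonempty and its supremum satisfies
`0 < Λ ≤ b g ⟦ρ⟧ / (4 μ₋)`; in particular `Λ` is finite. -/
theorem sup_growth_rate_pos_and_finite
    (b g ρm ρp μm μp σm σp : ℝ)
    (hb : 0 < b) (hg : 0 < g) (hρm : 0 < ρm) (hρ : ρm < ρp)
    (hμm : 0 < μm) (hμp : 0 < μp) (hσm : 0 ≤ σm) (hσp : 0 ≤ σp) :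
    (growthRates b g ρm ρp μm μp σm σp).Nonempty ∧
    0 < sSup (growthRates b g ρm ρp μm μp σm σp) ∧
    sSup (growthRates b g ρm ρp μm μp σm σp) ≤ b * g * (ρp - ρm) / (4 * μm) := by
  have hne := rate_exists hb hg hρm hρ hμm hμp hσm hσp
  have hub : ∀ s ∈ growthRates b g ρm ρp μm μp σm σp, s ≤ b * g * (ρp - ρm) / (4 * μm) :=
    fun s hs => rate_le hb hg hρm hρ hμm hμp hσm hσp hs
  refine ⟨hne, ?_, csSup_le hne hub⟩
  obtain ⟨s, hs⟩ := hne
  exact lt_of_lt_of_le hs.1 (le_csSup ⟨_, hub⟩ hs)
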